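/- For independent discrete demands, the detour-to-depot recourse computed by the Bellman recursion with the preventive-return option removed coincides with the closed-form expected-failure formula: define F^D((), q) := 0 and, for a list L = j :: L' of remaining customers and residual capacity q ∈ {0, …, Q}, F^D(j :: L', q) := ∑_{s∈ℕ} [ c^F_j · Ψ(s,q) + F^D(L', Ψ(s,q)·Q + q − s) ] · ρ_j(s). Then for every path p = (i_1, …, i_t) of distinct customers, F^D(p, Q) = ∑_{j=1}^{t} ∑_{l=1}^{∞} P[ ∑_{k=1}^{j−1} ξ_{i_k} ≤ lQ < ∑_{k=1}^{j} ξ_{i_k} ] · c^F_{i_j} = Q̄^DTD_p. -/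

import Mathlib

open ENNReal MeasureTheory

/-- `Ψ(s, q) = max(⌈(s − q)/Q⌉, 0)`: the number of restocking trips needed to serve a
demand of `s` units from residual capacity `q`, with vehicle capacity `Q`. -/
noncomputable def psi (Q s q : ℕ) : ℕ := (⌈((s : ℚ) - (q : ℚ)) / (Q : ℚ)⌉).toNat

/-- The Bellman recursion for the DTD policy (the OR recursion with the preventive-return
option removed): `F^D((), q) = 0` and
`F^D(j :: L', q) = ∑_s [ c^F_j Ψ(s,q) + F^D(L', Ψ(s,q)Q + q − s) ] ρ_j(s)`. -/
noncomputable def FD {N : Type*} (ρ : N → PMF ℕ) (Q : ℕ) (cF : N → ℝ) :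
    List N → ℕ → ℝ≥0∞
  | [], _ => 0
  | j :: L', q =>
      ∑' s : ℕ, (ENNReal.ofReal (cF j) * (psi Q s q : ℝ≥0∞)
        + FD ρ Q cF L' (psi Q s q * Q + q - s)) * ρ j s

/-- The closed-form expected-failure formula for the DTD recourse cost
`Q̄ᴰᵀᴰ_p = ∑_{j=1}^{t} ∑_{l=1}^{∞} P[ ∑_{k<j} ξ_{i_k} ≤ lQ < ∑_{k≤j} ξ_{i_k} ] · c^F_{i_j}`,
where the joint law of the independent demands is the product of their pmfs. -/
noncomputable def QbarDTDpi {N : Type*} [Fintype N] (ρ : N → PMF ℕ) (Q : ℕ)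
    (cF : N → ℝ) (p : List N) : ℝ≥0∞ :=
  ∑ j : Fin p.length, ∑' l : ℕ,
    Measure.pi (fun i => (ρ i).toMeasure)
        {ω : N → ℕ | ((p.take j).map ω).sum ≤ (l + 1) * Q ∧
          (l + 1) * Q < ((p.take (j + 1)).map ω).sum}
      * ENNReal.ofReal (cF (p.get j))


lemma lt_psi_iff (Q s q l : ℕ) (hQ : 1 ≤ Q) : l < psi Q s q ↔ q + l * Q < s := by
  unfold psi
  have hQ' : (0 : ℚ) < Q := by exact_mod_cast hQ
  rw [Int.lt_toNat, Int.lt_ceil, lt_div_iff₀ hQ', lt_sub_iff_add_lt]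
  constructor
  · intro h
    have : ((l * Q + q : ℕ) : ℚ) < (s : ℕ) := by push_cast; exact_mod_cast h
    have := Nat.cast_lt.mp this
    omega
  · intro h
    have h2 : ((q + l * Q : ℕ) : ℚ) < (s : ℕ) := Nat.cast_lt.mpr h
    push_cast at h2 ⊢
    linarith

lemma psi_tsum (Q s q : ℕ) (hQ : 1 ≤ Q) :
    (psi Q s q : ℝ≥0∞) = ∑' l : ℕ, if q + l * Q < s then 1 else 0 := by
  rw [tsum_eq_sum (s := Finset.range (psi Q s q))]
  · rw [Finset.sum_congr rfl (g := fun _ => 1)]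
    · simp
    · intro l hl
      rw [if_pos ((lt_psi_iff Q s q l hQ).1 (Finset.mem_range.1 hl))]
  · intro l hl
    rw [if_neg]
    rwa [← lt_psi_iff Q s q l hQ, ← Finset.mem_range]

/-- realized cost -/
noncomputable def GD {N : Type*} (Q : ℕ) (cF : N → ℝ) (ω : N → ℕ) : List N → ℕ → ℝ≥0∞
  | [], _ => 0
  | j :: L', q => ENNReal.ofReal (cF j) * (psi Q (ω j) q : ℝ≥0∞)
        + GD Q cF ω L' (psi Q (ω j) q * Q + q - ω j)

lemma GD_congr {N : Type*} (Q : ℕ) (cF : N → ℝ) (ω ω' : N → ℕ) (L : List N)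
    (h : ∀ i ∈ L, ω i = ω' i) (q : ℕ) : GD Q cF ω L q = GD Q cF ω' L q := by
  induction L generalizing q with
  | nil => rfl
  | cons j L ih =>
    simp only [GD]
    rw [h j (by simp), ih (fun i hi => h i (by simp [hi]))]

lemma GD_eq {N : Type*} (Q : ℕ) (hQ : 1 ≤ Q) (cF : N → ℝ) (ω : N → ℕ) (p : List N) (q : ℕ) :
    GD Q cF ω p q = ∑ j : Fin p.length, ∑' l : ℕ,
      (if ((p.take j).map ω).sum ≤ q + l * Q ∧ q + l * Q < ((p.take (j + 1)).map ω).sum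
        then 1 else 0) * ENNReal.ofReal (cF (p.get j)) := by
  induction p generalizing q with
  | nil => simp [GD]
  | cons i L ih =>
    simp only [GD]
    rw [ih]
    change _ = ∑ j : Fin (L.length + 1), _
    rw [Fin.sum_univ_succ]
    congr 1
    · rw [ENNReal.tsum_mul_right, psi_tsum _ _ _ hQ, mul_comm]
      simp
    · refine Finset.sum_congr rfl fun j _ => ?_
      rw [ENNReal.tsum_mul_right, ENNReal.tsum_mul_right]
      congr 1
      have hinj : Function.Injective (fun l : ℕ => l + psi Q (ω i) q) :=
        fun a b h => by simpa using h
      have hps : ω i ≤ psi Q (ω i) q * Q + q := by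
        have := (lt_psi_iff Q (ω i) q (psi Q (ω i) q) hQ).not.1 (lt_irrefl _)
        omega
      symm
      rw [← hinj.tsum_eq]
      · refine tsum_congr fun l => ?_
        have e : ((l + psi Q (ω i) q) * Q) = l * Q + psi Q (ω i) q * Q := by ring
        simp only [Fin.val_succ, List.take_succ_cons, List.map_cons, List.sum_cons, e]
        refine if_congr ?_ rfl rfl
        omega
      · intro l hl
        simp only [Function.mem_support, ne_eq, ite_eq_right_iff, not_forall] at hl
        obtain ⟨⟨h1, _⟩, _⟩ := hl
        simp only [Fin.val_succ, List.take_succ_cons, List.map_cons, List.sum_cons] at h1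
        have := (lt_psi_iff Q (ω i) q l hQ).not.2 (by omega)
        exact ⟨l - psi Q (ω i) q, by simp only; omega⟩

lemma lintegral_pi_update {N : Type*} [Fintype N] [DecidableEq N] (ρ : N → PMF ℕ) (j : N)
    (f : (N → ℕ) → ℝ≥0∞) :
    ∫⁻ ω, f ω ∂Measure.pi (fun i => (ρ i).toMeasure) =
      ∫⁻ ω, (∫⁻ x, f (Function.update ω j x) ∂(ρ j).toMeasure)
        ∂Measure.pi (fun i => (ρ i).toMeasure) := by
  have hm : ∀ g : (N → ℕ) → ℝ≥0∞, Measurable g := fun g => Measurable.of_discrete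
  rw [lintegral_eq_lmarginal_univ (fun _ => 0), lintegral_eq_lmarginal_univ (fun _ => 0),
    lmarginal_erase' _ (hm _) (Finset.mem_univ j), lmarginal_erase' _ (hm _) (Finset.mem_univ j)]
  simp

lemma FD_eq_lintegral {N : Type*} [Fintype N] (ρ : N → PMF ℕ) (Q : ℕ)
    (cF : N → ℝ) (p : List N) (hp : p.Nodup) (q : ℕ) :
    FD ρ Q cF p q = ∫⁻ ω, GD Q cF ω p q ∂Measure.pi (fun i => (ρ i).toMeasure) := by
  classical
  induction p generalizing q with
  | nil => simp [FD, GD]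
  | cons j L ih =>
    rw [List.nodup_cons] at hp
    rw [lintegral_pi_update ρ j]
    simp only [FD, GD, Function.update_self]
    have h : ∀ (ω : N → ℕ) (x q' : ℕ), GD Q cF (Function.update ω j x) L q' = GD Q cF ω L q' := by
      intro ω x q'
      apply GD_congr
      intro i hi
      rw [Function.update_of_ne]
      rintro rfl
      exact hp.1 hi
    simp only [h, lintegral_countable']
    rw [← lintegral_countable']
    rw [lintegral_tsum (fun _ => (Measurable.of_discrete).aemeasurable)]
    refine tsum_congr fun s => ?_
    rw [lintegral_mul_const _ Measurable.of_discrete, lintegral_add_left measurable_const,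
      ← ih hp.2]
    simp [PMF.toMeasure_apply_singleton]

theorem FD_eq_QbarDTD
    {N : Type*} [Fintype N] (ρ : N → PMF ℕ) (Q : ℕ) (hQ : 1 ≤ Q)
    (hmean : ∀ i, ∑' s : ℕ, (s : ℝ≥0∞) * ρ i s ≠ ⊤)
    (cF : N → ℝ) (hcF : ∀ i, 0 ≤ cF i)
    (p : List N) (hp : p.Nodup) :
    FD ρ Q cF p Q = QbarDTDpi ρ Q cF p := by
  rw [FD_eq_lintegral ρ Q cF p hp]
  simp only [GD_eq Q hQ]
  unfold QbarDTDpi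
  rw [lintegral_finsetSum _ (fun _ _ => Measurable.of_discrete)]
  refine Finset.sum_congr rfl fun j _ => ?_
  rw [lintegral_tsum (fun _ => (Measurable.of_discrete).aemeasurable)]
  refine tsum_congr fun l => ?_
  rw [lintegral_mul_const _ Measurable.of_discrete]
  congr 1
  rw [← lintegral_indicator_one (MeasurableSet.of_discrete)]
  refine lintegral_congr fun ω => ?_
  have e : (l + 1) * Q = Q + l * Q := by ring
  simp only [Set.indicator_apply, Set.mem_setOf_eq, e, Pi.one_apply]
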